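/- arXiv:2011.04073 — 7 statements merged into one kernel-verified Lean document; each statement's English description precedes it below -/
import Mathlib

section
/- Let α, β be constants with α ≠ β² and let g be the contravariant metric on {(u,v) ∈ ℝ² : u > 0} with matrix (g^{ij}) = [[u, β],[β, α/u]]. Then: (1) the contravariant Christoffel symbols of g are Γ^{11}₁ = 1/2, Γ^{21}₂ = 1/2, Γ^{12}₂ = −1/2, Γ^{22}₁ = −α/(2u²), and Γ^{12}₁ = Γ^{21}₁ = Γ^{22}₂ = Γ^{11}₂ = 0; (2) g is flat; (3) g is compatible with η; (4) f = ∂_v is a Killing vector field of g. -/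
open scoped BigOperators

/-- Partial derivative of a function on `ℝⁿ` in the `i`-th coordinate direction. -/
noncomputable def pd {n : ℕ} (i : Fin n) (f : (Fin n → ℝ) → ℝ) (x : Fin n → ℝ) : ℝ :=
  fderiv ℝ f x (Pi.single i 1)

/-- The covariant metric `g_{ij}`: the pointwise matrix inverse of the contravariant
metric `g^{ij}`. -/
noncomputable def covMetric {n : ℕ} (g : (Fin n → ℝ) → Matrix (Fin n) (Fin n) ℝ)
    (x : Fin n → ℝ) : Matrix (Fin n) (Fin n) ℝ := (g x)⁻¹

/-- The Levi-Civita Christoffel symbols `Γ^i_{jk}` of the covariant metric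
`g_{ij} = (g^{ij})⁻¹`, with the upper index raised with `g^{is}`. -/
noncomputable def christoffel {n : ℕ} (g : (Fin n → ℝ) → Matrix (Fin n) (Fin n) ℝ)
    (i j k : Fin n) (x : Fin n → ℝ) : ℝ :=
  (1 / 2) * ∑ s, g x i s *
    (pd j (fun y => covMetric g y s k) x + pd k (fun y => covMetric g y s j) x
      - pd s (fun y => covMetric g y j k) x)

/-- The Riemann curvature tensor `R^i_{jkl}` of the Levi-Civita connection of `g_{ij}`. -/
noncomputable def riemann {n : ℕ} (g : (Fin n → ℝ) → Matrix (Fin n) (Fin n) ℝ)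
    (i j k l : Fin n) (x : Fin n → ℝ) : ℝ :=
  pd k (christoffel g i l j) x - pd l (christoffel g i k j) x
    + ∑ s, (christoffel g i k s x * christoffel g s l j x
      - christoffel g i l s x * christoffel g s k j x)

/-- The contravariant Christoffel symbols `Γ^{ij}_k = −g^{is} Γ^j_{sk}`. -/
noncomputable def contraChristoffel {n : ℕ} (g : (Fin n → ℝ) → Matrix (Fin n) (Fin n) ℝ)
    (i j k : Fin n) (x : Fin n → ℝ) : ℝ :=
  - ∑ s, g x i s * christoffel g j s k x

/-- The contravariant metric `g` is flat on `U`. -/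
def IsFlatOn {n : ℕ} (g : (Fin n → ℝ) → Matrix (Fin n) (Fin n) ℝ)
    (U : Set (Fin n → ℝ)) : Prop :=
  ∀ x ∈ U, ∀ i j k l, riemann g i j k l x = 0

/-- The Lie derivative `(L_f g)^{ij} = f^k ∂_k g^{ij} − g^{kj} ∂_k f^i − g^{ik} ∂_k f^j`
of the contravariant 2-tensor `g` along the vector field `f`. -/
noncomputable def lieD {n : ℕ} (f : (Fin n → ℝ) → (Fin n → ℝ))
    (g : (Fin n → ℝ) → Matrix (Fin n) (Fin n) ℝ) (i j : Fin n) (x : Fin n → ℝ) : ℝ :=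
  ∑ k, (f x k * pd k (fun y => g y i j) x
    - g x k j * pd k (fun y => f y i) x - g x i k * pd k (fun y => f y j) x)

/-- `f` is a Killing vector field (infinitesimal isometry) of `g` on `U`. -/
def IsKillingOn {n : ℕ} (f : (Fin n → ℝ) → (Fin n → ℝ))
    (g : (Fin n → ℝ) → Matrix (Fin n) (Fin n) ℝ) (U : Set (Fin n → ℝ)) : Prop :=
  ∀ x ∈ U, ∀ i j, lieD f g i j x = 0

/-- `g` is compatible with `h` on `U`: for every `λ`, at every point of `U` where
`g + λ h` is non-degenerate, `g + λ h` is flat and its contravariant Christoffel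
symbols coincide with those of `g`. -/
def CompatibleOn {n : ℕ} (g h : (Fin n → ℝ) → Matrix (Fin n) (Fin n) ℝ)
    (U : Set (Fin n → ℝ)) : Prop :=
  ∀ lam : ℝ, ∀ x ∈ U, (g x + lam • h x).det ≠ 0 →
    (∀ i j k l, riemann (fun y => g y + lam • h y) i j k l x = 0) ∧
    (∀ i j k, contraChristoffel (fun y => g y + lam • h y) i j k x =
      contraChristoffel g i j k x)

/-- The constant contravariant metric `η` on `ℝ²` with matrix `[[0,1],[1,0]]`. -/
def eta2 : Matrix (Fin 2) (Fin 2) ℝ := !![0, 1; 1, 0]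

/-- The metric `g₁` (with `u` and `v` interchanged) underlying the bi-Hamiltonian
structure of the constant astigmatism equation. -/
noncomputable def gCA (α β : ℝ) : (Fin 2 → ℝ) → Matrix (Fin 2) (Fin 2) ℝ :=
  fun x => !![x 0, β; β, α / x 0]

/-- The domain `{(u,v) ∈ ℝ² : u > 0}`. -/
def Upos : Set (Fin 2 → ℝ) := {x | 0 < x 0}

/-- A function equal to `φ (y 0)` on the half plane has partial derivatives `φ'` and `0`. -/
theorem pd_eq_of_eqOn_Upos {f : (Fin 2 → ℝ) → ℝ} {φ : ℝ → ℝ} {φ' : ℝ} {x : Fin 2 → ℝ}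
    (hx : x ∈ Upos) (hf : ∀ y ∈ Upos, f y = φ (y 0)) (hφ : HasDerivAt φ φ' (x 0)) (i : Fin 2) :
    pd i f x = if i = 0 then φ' else 0 := by
  have hU : IsOpen Upos := isOpen_lt continuous_const (continuous_apply 0)
  have hev : f =ᶠ[nhds x] fun y => φ (y 0) :=
    Filter.eventually_of_mem (hU.mem_nhds hx) hf
  have h0 : HasFDerivAt (fun y : Fin 2 → ℝ => y 0)
      (ContinuousLinearMap.proj (R := ℝ) (φ := fun _ : Fin 2 => ℝ) 0) x :=
    (ContinuousLinearMap.proj (R := ℝ) (φ := fun _ : Fin 2 => ℝ) 0).hasFDerivAt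
  have h1 : HasFDerivAt (fun y : Fin 2 → ℝ => φ (y 0)) _ x := hφ.comp_hasFDerivAt x h0
  rw [pd, hev.fderiv_eq, h1.fderiv]
  fin_cases i <;> simp

/-- The partial derivatives of a Laurent polynomial in `u` of the shape occurring for `gCA`. -/
theorem pd_eq_of_laurent {f : (Fin 2 → ℝ) → ℝ} {x : Fin 2 → ℝ} (a b c d : ℝ)
    (hx : x ∈ Upos) (hf : ∀ y ∈ Upos, f y = a + b * y 0 + c / y 0 + d / y 0 ^ 2) (i : Fin 2) :
    pd i f x = if i = 0 then b - c / x 0 ^ 2 - 2 * d / x 0 ^ 3 else 0 := by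
  have hu : x 0 ≠ 0 := ne_of_gt hx
  refine pd_eq_of_eqOn_Upos (φ := fun u => a + b * u + c / u + d / u ^ 2) hx hf ?_ i
  have h := ((((hasDerivAt_id (x 0)).const_mul b).const_add a).add
    ((hasDerivAt_const (x 0) c).div (hasDerivAt_id (x 0)) hu)).add
    ((hasDerivAt_const (x 0) d).div ((hasDerivAt_id (x 0)).pow 2) (pow_ne_zero 2 hu))
  refine h.congr_deriv ?_
  simp only [id, Pi.pow_apply]
  field_simp
  ring

theorem covMetric_gCA {α β : ℝ} {x : Fin 2 → ℝ} (hx : x ∈ Upos) :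
    covMetric (gCA α β) x =
      !![α / (α - β ^ 2) / x 0, -β / (α - β ^ 2); -β / (α - β ^ 2), x 0 / (α - β ^ 2)] := by
  have hu : x 0 ≠ 0 := ne_of_gt hx
  have hdet : (gCA α β x).det = α - β ^ 2 := by
    rw [gCA, Matrix.det_fin_two_of]
    field_simp
  rw [covMetric, Matrix.inv_def, hdet, gCA, Matrix.adjugate_fin_two_of, Ring.inverse_eq_inv']
  ext i j
  fin_cases i <;> fin_cases j <;> simp <;> ring

theorem pd_covMetric_gCA {α β : ℝ} {x : Fin 2 → ℝ} (hx : x ∈ Upos) (k i j : Fin 2) :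
    pd k (fun y => covMetric (gCA α β) y i j) x =
      if k = 0 then
        !![-(α / (α - β ^ 2)) / x 0 ^ 2, 0; 0, 1 / (α - β ^ 2)] i j
      else 0 := by
  rw [pd_eq_of_laurent (!![0, -β / (α - β ^ 2); -β / (α - β ^ 2), 0] i j)
    (!![0, 0; 0, 1 / (α - β ^ 2)] i j) (!![α / (α - β ^ 2), 0; 0, 0] i j) 0 hx]
  · fin_cases i <;> fin_cases j <;> simp [neg_div]
  · intro y hy
    rw [covMetric_gCA hy]
    fin_cases i <;> fin_cases j <;> simp
    ring

/-- The Levi-Civita Christoffel symbols of `gCA`. -/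
theorem christoffel_gCA {α β : ℝ} {x : Fin 2 → ℝ} (hx : x ∈ Upos) (i j k : Fin 2) :
    christoffel (gCA α β) i j k x =
      ![!![-α / (2 * (α - β ^ 2)) / x 0, β / (2 * (α - β ^ 2));
           β / (2 * (α - β ^ 2)), -1 / (2 * (α - β ^ 2)) * x 0],
        !![-(α * β) / (2 * (α - β ^ 2)) / x 0 ^ 2, α / (2 * (α - β ^ 2)) / x 0;
           α / (2 * (α - β ^ 2)) / x 0, -β / (2 * (α - β ^ 2))]] i j k := by
  have hu : x 0 ≠ 0 := ne_of_gt hx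
  simp only [christoffel, Fin.sum_univ_two, pd_covMetric_gCA hx]
  fin_cases i <;> fin_cases j <;> fin_cases k <;> simp [gCA] <;> field_simp

theorem pd_christoffel_gCA {α β : ℝ} {x : Fin 2 → ℝ} (hx : x ∈ Upos) (l i j k : Fin 2) :
    pd l (christoffel (gCA α β) i j k) x =
      if l = 0 then
        ![!![α / (2 * (α - β ^ 2)) / x 0 ^ 2, 0; 0, -1 / (2 * (α - β ^ 2))],
          !![α * β / (α - β ^ 2) / x 0 ^ 3, -α / (2 * (α - β ^ 2)) / x 0 ^ 2;
             -α / (2 * (α - β ^ 2)) / x 0 ^ 2, 0]] i j k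
      else 0 := by
  have hu : x 0 ≠ 0 := ne_of_gt hx
  rw [pd_eq_of_laurent
    (![!![0, β / (2 * (α - β ^ 2)); β / (2 * (α - β ^ 2)), 0],
       !![0, 0; 0, -β / (2 * (α - β ^ 2))]] i j k)
    (![!![0, 0; 0, -1 / (2 * (α - β ^ 2))], !![0, 0; 0, 0]] i j k)
    (![!![-α / (2 * (α - β ^ 2)), 0; 0, 0],
       !![0, α / (2 * (α - β ^ 2)); α / (2 * (α - β ^ 2)), 0]] i j k)
    (![!![0, 0; 0, 0], !![-(α * β) / (2 * (α - β ^ 2)), 0; 0, 0]] i j k) hx]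
  · congr 1
    fin_cases i <;> fin_cases j <;> fin_cases k <;> simp <;> field_simp
  · intro y hy
    rw [christoffel_gCA hy]
    fin_cases i <;> fin_cases j <;> fin_cases k <;> simp

theorem isFlatOn_gCA {α β : ℝ} (h : α ≠ β ^ 2) : IsFlatOn (gCA α β) Upos := by
  intro x hx i j k l
  have hu : x 0 ≠ 0 := ne_of_gt hx
  have hD : α - β ^ 2 ≠ 0 := sub_ne_zero.mpr h
  simp only [riemann, Fin.sum_univ_two, pd_christoffel_gCA hx, christoffel_gCA hx]
  fin_cases i <;> fin_cases j <;> fin_cases k <;> fin_cases l <;> simp <;> field_simp <;> ring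

/-- The contravariant Christoffel symbols of `gCA`; they do not depend on `β`. -/
theorem contraChristoffel_gCA {α β : ℝ} (h : α ≠ β ^ 2) {x : Fin 2 → ℝ} (hx : x ∈ Upos)
    (i j k : Fin 2) :
    contraChristoffel (gCA α β) i j k x =
      ![!![1 / 2, 0; 0, -(1 / 2)], !![0, 1 / 2; -α / (2 * x 0 ^ 2), 0]] i j k := by
  have hu : x 0 ≠ 0 := ne_of_gt hx
  have hD : α - β ^ 2 ≠ 0 := sub_ne_zero.mpr h
  simp only [contraChristoffel, Fin.sum_univ_two, christoffel_gCA hx]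
  fin_cases i <;> fin_cases j <;> fin_cases k <;> simp [gCA] <;> field_simp <;> ring

theorem gCA_add_smul_eta2 (α β lam : ℝ) (x : Fin 2 → ℝ) :
    gCA α β x + lam • eta2 = gCA α (β + lam) x := by
  ext i j
  fin_cases i <;> fin_cases j <;> simp [gCA, eta2]

theorem compatibleOn_gCA_eta2 {α β : ℝ} (h : α ≠ β ^ 2) :
    CompatibleOn (gCA α β) (fun _ => eta2) Upos := by
  intro lam x hx hdet
  simp only [gCA_add_smul_eta2] at hdet ⊢
  have hu : x 0 ≠ 0 := ne_of_gt hx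
  have h' : α ≠ (β + lam) ^ 2 := by
    rintro rfl
    apply hdet
    rw [gCA, Matrix.det_fin_two_of]
    field_simp
    ring
  refine ⟨isFlatOn_gCA h' x hx, fun i j k => ?_⟩
  rw [contraChristoffel_gCA h' hx, contraChristoffel_gCA h hx]

theorem isKillingOn_gCA (α β : ℝ) : IsKillingOn (fun _ => ![0, 1]) (gCA α β) Upos := by
  intro x hx i j
  have h1 : pd 1 (fun y => gCA α β y i j) x = 0 := by
    rw [pd_eq_of_laurent (!![0, β; β, 0] i j) (!![1, 0; 0, 0] i j) (!![0, 0; 0, α] i j) 0 hx]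
    · simp
    · intro y hy
      fin_cases i <;> fin_cases j <;> simp [gCA]
  have hc : ∀ (k : Fin 2) (c : ℝ), pd k (fun _ : Fin 2 → ℝ => c) x = 0 := by
    simp [pd]
  simp [lieD, Fin.sum_univ_two, h1, hc]

/-- for the contravariant metric `g = [[u, β],[β, α/u]]` on `{u > 0}` with
`α ≠ β²`: (1) the contravariant Christoffel symbols are `Γ^{11}₁ = 1/2`, `Γ^{21}₂ = 1/2`,
`Γ^{12}₂ = −1/2`, `Γ^{22}₁ = −α/(2u²)`, and `Γ^{12}₁ = Γ^{21}₁ = Γ^{22}₂ = Γ^{11}₂ = 0`;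
(2) `g` is flat; (3) `g` is compatible with `η`; (4) `f = ∂_v` is a Killing vector field
of `g`. -/
theorem stmt6 (α β : ℝ) (hαβ : α ≠ β ^ 2) :
    (∀ x ∈ Upos,
      contraChristoffel (gCA α β) 0 0 0 x = 1 / 2 ∧
      contraChristoffel (gCA α β) 1 0 1 x = 1 / 2 ∧
      contraChristoffel (gCA α β) 0 1 1 x = -(1 / 2) ∧
      contraChristoffel (gCA α β) 1 1 0 x = -α / (2 * (x 0) ^ 2) ∧
      contraChristoffel (gCA α β) 0 1 0 x = 0 ∧
      contraChristoffel (gCA α β) 1 0 0 x = 0 ∧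
      contraChristoffel (gCA α β) 1 1 1 x = 0 ∧
      contraChristoffel (gCA α β) 0 0 1 x = 0) ∧
    IsFlatOn (gCA α β) Upos ∧
    CompatibleOn (gCA α β) (fun _ => eta2) Upos ∧
    IsKillingOn (fun _ => ![0, 1]) (gCA α β) Upos := by
  refine ⟨fun x hx => ?_, isFlatOn_gCA hαβ, compatibleOn_gCA_eta2 hαβ, isKillingOn_gCA α β⟩
  simp [contraChristoffel_gCA hαβ hx]
end

section
/- Let α, β, ε be constants with β ≠ 0 and let g₇ be the contravariant metric on {(u,v) ∈ ℝ² : v ≠ 0} with matrix (g₇^{ij}) = [[(αuv+ε)/v², β],[β, 0]]. Then g₇ is flat, g₇ is compatible with η, and f = u∂_u − v∂_v is a Killing vector field of g₇. -/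
open scoped BigOperators

/-- The canonical metric `g₇`. -/
noncomputable def g7 (α β ε : ℝ) : (Fin 2 → ℝ) → Matrix (Fin 2) (Fin 2) ℝ :=
  fun x => !![(α * x 0 * x 1 + ε) / (x 1) ^ 2, β; β, 0]

/-- The domain `{(u,v) ∈ ℝ² : v ≠ 0}`. -/
def Uv : Set (Fin 2 → ℝ) := {x | x 1 ≠ 0}

lemma pd_const_mul {n : ℕ} (i : Fin n) (c : ℝ) (f : (Fin n → ℝ) → ℝ) (x : Fin n → ℝ) :
    pd i (fun y => c * f y) x = c * pd i f x := by
  have h := fderiv_const_smul_field (𝕜 := ℝ) c (f := f)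
  simp only [pd]
  change fderiv ℝ (c • f) x _ = _
  rw [h]
  rfl

lemma pd_const {n : ℕ} (i : Fin n) (c : ℝ) (x : Fin n → ℝ) :
    pd i (fun _ => c) x = 0 := by
  simp [pd]

lemma pd_eq_of_hasDerivAt {n : ℕ} {i : Fin n} {f : (Fin n → ℝ) → ℝ} {x : Fin n → ℝ} {d : ℝ}
    (hf : DifferentiableAt ℝ f x)
    (hd : HasDerivAt (fun t => f (Function.update x i t)) d (x i)) : pd i f x = d := by
  have h := HasFDerivAt.comp_hasDerivAt (x i) (f := Function.update x i)
    (by simpa using hf.hasFDerivAt) (hasDerivAt_update x i (x i))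
  exact h.unique hd

lemma pd_congr {n : ℕ} {i : Fin n} {f g : (Fin n → ℝ) → ℝ} {x : Fin n → ℝ}
    (h : f =ᶠ[nhds x] g) : pd i f x = pd i g x := by
  simp only [pd, h.fderiv_eq]

/-- The contravariant metric on `ℝ²` with matrix `[[a, b], [b, 0]]`, where `b` is constant. -/
def antiTriangularMetric (a : (Fin 2 → ℝ) → ℝ) (b : ℝ) :
    (Fin 2 → ℝ) → Matrix (Fin 2) (Fin 2) ℝ :=
  fun x => !![a x, b; b, 0]

section AntiTriangular

variable (a : (Fin 2 → ℝ) → ℝ) {b : ℝ}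

lemma covMetric_antiTriangularMetric (hb : b ≠ 0) (x : Fin 2 → ℝ) :
    covMetric (antiTriangularMetric a b) x = !![0, b⁻¹; b⁻¹, -(b⁻¹ ^ 2) * a x] := by
  refine Matrix.inv_eq_right_inv ?_
  ext i j
  fin_cases i <;> fin_cases j <;>
    simp [antiTriangularMetric, Matrix.mul_apply, Fin.sum_univ_two, hb]
  field_simp
  ring

/-- The Levi-Civita Christoffel symbols of `antiTriangularMetric a b`: first index up. -/
lemma christoffel_antiTriangularMetric (hb : b ≠ 0) (i j k : Fin 2) :
    christoffel (antiTriangularMetric a b) i j k =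
      ![!![fun _ => 0, fun x => (-(2 * b)⁻¹) * pd 0 a x;
          fun x => (-(2 * b)⁻¹) * pd 0 a x,
          fun x => (2 * b ^ 2)⁻¹ * (a x * pd 0 a x - b * pd 1 a x)],
        !![fun _ => 0, fun _ => 0; fun _ => 0, fun x => (2 * b)⁻¹ * pd 0 a x]] i j k := by
  funext x
  simp only [christoffel, covMetric_antiTriangularMetric a hb, Fin.sum_univ_two]
  fin_cases i <;> fin_cases j <;> fin_cases k <;>
    simp [antiTriangularMetric, pd_const, pd_const_mul, -neg_mul] <;> field_simp <;> ring

lemma contraChristoffel_antiTriangularMetric (hb : b ≠ 0) (i j k : Fin 2) (x : Fin 2 → ℝ) :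
    contraChristoffel (antiTriangularMetric a b) i j k x =
      ![![fun k => pd k a x / 2, ![0, -(pd 0 a x / 2)]], ![![0, pd 0 a x / 2], ![0, 0]]] i j k := by
  simp only [contraChristoffel, christoffel_antiTriangularMetric a hb, Fin.sum_univ_two]
  fin_cases i <;> fin_cases j <;> fin_cases k <;>
    simp [antiTriangularMetric] <;> field_simp <;> ring

lemma riemann_antiTriangularMetric_eq_zero (hb : b ≠ 0) {x : Fin 2 → ℝ}
    (ha : DifferentiableAt ℝ a x) (ha0 : DifferentiableAt ℝ (pd 0 a) x)
    (ha1 : DifferentiableAt ℝ (pd 1 a) x) (h00 : pd 0 (pd 0 a) x = 0)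
    (h01 : pd 0 (pd 1 a) x = pd 1 (pd 0 a) x) (i j k l : Fin 2) :
    riemann (antiTriangularMetric a b) i j k l x = 0 := by
  have hpd : pd 0 (fun y => a y * pd 0 a y - b * pd 1 a y) x =
      pd 0 a x ^ 2 - b * pd 1 (pd 0 a) x := by
    have h := (ha.hasFDerivAt.mul ha0.hasFDerivAt).sub (ha1.hasFDerivAt.const_mul b)
    have h' := congrArg (fun L => L (Pi.single 0 1)) h.fderiv
    simp only [pd] at h00 h01 ⊢
    refine h'.trans ?_
    simp [h00, h01, pd]
    ring
  simp only [riemann, christoffel_antiTriangularMetric a hb, Fin.sum_univ_two]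
  fin_cases i <;> fin_cases j <;> fin_cases k <;> fin_cases l <;>
    simp [pd_const, pd_const_mul, h00, hpd, -neg_mul] <;> field_simp <;> ring

end AntiTriangular

section Potential

variable (α ε : ℝ) {x : Fin 2 → ℝ}

lemma differentiableAt_potential (hx : x 1 ≠ 0) :
    DifferentiableAt ℝ (fun y : Fin 2 → ℝ => (α * y 0 * y 1 + ε) / y 1 ^ 2) x := by
  have : x 1 ^ 2 ≠ 0 := pow_ne_zero 2 hx
  fun_prop (disch := assumption)

lemma pd_zero_potential (hx : x 1 ≠ 0) :
    pd 0 (fun y : Fin 2 → ℝ => (α * y 0 * y 1 + ε) / y 1 ^ 2) x = α / x 1 := by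
  refine pd_eq_of_hasDerivAt (differentiableAt_potential α ε hx) ?_
  have h := ((((hasDerivAt_id (x 0)).const_mul α).mul_const (x 1)).add_const ε).div_const (x 1 ^ 2)
  refine h.congr_deriv ?_
  field_simp

lemma pd_one_potential (hx : x 1 ≠ 0) :
    pd 1 (fun y : Fin 2 → ℝ => (α * y 0 * y 1 + ε) / y 1 ^ 2) x =
      -(α * x 0 * x 1 + 2 * ε) / x 1 ^ 3 := by
  refine pd_eq_of_hasDerivAt (differentiableAt_potential α ε hx) ?_
  have h := (((hasDerivAt_id (x 1)).const_mul (α * x 0)).add_const ε).div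
    ((hasDerivAt_id (x 1)).pow 2) (pow_ne_zero 2 hx)
  refine h.congr_deriv ?_
  simp
  field_simp
  ring

lemma isOpen_Uv : IsOpen Uv := isOpen_ne_fun (continuous_apply 1) continuous_const

lemma riemann_potential_eq_zero {b : ℝ} (hb : b ≠ 0) (hx : x ∈ Uv) (i j k l : Fin 2) :
    riemann (antiTriangularMetric (fun y => (α * y 0 * y 1 + ε) / y 1 ^ 2) b) i j k l x = 0 := by
  have hx1 : x 1 ≠ 0 := hx
  have hx3 : x 1 ^ 3 ≠ 0 := pow_ne_zero 3 hx1
  have hU : ∀ᶠ y in nhds x, y ∈ Uv := isOpen_Uv.mem_nhds hx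
  have e0 := hU.mono fun y hy => pd_zero_potential α ε hy
  have e1 := hU.mono fun y hy => pd_one_potential α ε hy
  have d0 : DifferentiableAt ℝ (fun y : Fin 2 → ℝ => α / y 1) x := by
    fun_prop (disch := assumption)
  have d1 : DifferentiableAt ℝ
      (fun y : Fin 2 → ℝ => -(α * y 0 * y 1 + 2 * ε) / y 1 ^ 3) x := by
    fun_prop (disch := assumption)
  refine riemann_antiTriangularMetric_eq_zero _ hb (differentiableAt_potential α ε hx1)
    (d0.congr_of_eventuallyEq e0) (d1.congr_of_eventuallyEq e1) ?_ ?_ i j k l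
  · rw [pd_congr e0]
    exact pd_eq_of_hasDerivAt d0 (by simpa using hasDerivAt_const (x 0) (α / x 1))
  · rw [pd_congr e0, pd_congr e1]
    have h0 : pd 0 (fun y : Fin 2 → ℝ => -(α * y 0 * y 1 + 2 * ε) / y 1 ^ 3) x =
        -α / x 1 ^ 2 := by
      refine pd_eq_of_hasDerivAt d1 ?_
      have h := ((((hasDerivAt_id (x 0)).const_mul α).mul_const (x 1)).add_const
        (2 * ε)).neg.div_const (x 1 ^ 3)
      refine h.congr_deriv ?_
      field_simp
    have h1 : pd 1 (fun y : Fin 2 → ℝ => α / y 1) x = -α / x 1 ^ 2 := by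
      refine pd_eq_of_hasDerivAt d0 ?_
      have h := (hasDerivAt_const (x 1) α).div (hasDerivAt_id (x 1)) hx1
      refine h.congr_deriv ?_
      simp
    rw [h0, h1]

lemma g7_eq_antiTriangularMetric (β : ℝ) :
    g7 α β ε = antiTriangularMetric (fun y => (α * y 0 * y 1 + ε) / y 1 ^ 2) β := rfl

lemma g7_add_smul_eta2 (β lam : ℝ) :
    (fun y => g7 α β ε y + lam • eta2) = g7 α (β + lam) ε := by
  funext y
  ext i j
  fin_cases i <;> fin_cases j <;> simp [g7, eta2]

lemma isKillingOn_g7 (β : ℝ) :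
    IsKillingOn (fun x => ![x 0, -x 1]) (g7 α β ε) Uv := by
  intro x hx i j
  have hx1 : x 1 ≠ 0 := hx
  have hp : ∀ k l : Fin 2, pd k (fun y : Fin 2 → ℝ => y l) x = if k = l then 1 else 0 := by
    intro k l
    have h := (hasFDerivAt_apply (𝕜 := ℝ) l x).fderiv
    simp only [pd, h]
    simp [Pi.single_apply, eq_comm]
  have hn : ∀ k : Fin 2, pd k (fun y : Fin 2 → ℝ => -y 1) x = -pd k (fun y => y 1) x := by
    intro k
    simpa using pd_const_mul k (-1) (fun y : Fin 2 → ℝ => y 1) x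
  simp only [lieD, Fin.sum_univ_two]
  fin_cases i <;> fin_cases j <;>
    simp [g7, hp, hn, pd_const, pd_zero_potential α ε hx1, pd_one_potential α ε hx1]
  field_simp
  ring

end Potential

/-- for constants `α, β, ε` with `β ≠ 0`, the contravariant metric
`g₇ = [[(αuv+ε)/v², β],[β, 0]]` on `{v ≠ 0}` is flat, compatible with `η`, and
`f = u∂_u − v∂_v` is a Killing vector field of `g₇`. -/
theorem stmt7 (α β ε : ℝ) (hβ : β ≠ 0) :
    IsFlatOn (g7 α β ε) Uv ∧
    CompatibleOn (g7 α β ε) (fun _ => eta2) Uv ∧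
    IsKillingOn (fun x => ![x 0, -x 1]) (g7 α β ε) Uv := by
  refine ⟨fun x hx => riemann_potential_eq_zero α ε hβ hx, fun lam x hx hdet => ?_,
    isKillingOn_g7 α ε β⟩
  have hb : β + lam ≠ 0 := by
    rintro h
    apply hdet
    rw [congrFun (g7_add_smul_eta2 α ε β lam) x, h]
    simp [g7, Matrix.det_fin_two]
  rw [g7_add_smul_eta2]
  refine ⟨riemann_potential_eq_zero α ε hb hx, fun i j k => ?_⟩
  simp only [g7_eq_antiTriangularMetric, contraChristoffel_antiTriangularMetric _ hb,
    contraChristoffel_antiTriangularMetric _ hβ]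
end

section
/- Let β ≠ 0 be a constant, let F : ℝ → ℝ be a smooth function, and let g₄ be the contravariant metric with matrix (g₄^{ij}(u,v)) = [[F(v−u), −F(v−u)+β],[−F(v−u)+β, F(v−u)]], restricted to the open set where 2βF(v−u) − β² ≠ 0 (non-degeneracy). Then g₄ is flat, g₄ is compatible with η, and f = ∂_u + ∂_v is a Killing vector field of g₄. -/
open scoped BigOperators

/-- The canonical metric `g₄`. -/
noncomputable def g4 (β : ℝ) (F : ℝ → ℝ) : (Fin 2 → ℝ) → Matrix (Fin 2) (Fin 2) ℝ :=
  fun x => !![F (x 1 - x 0), -F (x 1 - x 0) + β; -F (x 1 - x 0) + β, F (x 1 - x 0)]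

/-- The open set where `g₄` is non-degenerate. -/
def U4 (β : ℝ) (F : ℝ → ℝ) : Set (Fin 2 → ℝ) :=
  {x | 2 * β * F (x 1 - x 0) - β ^ 2 ≠ 0}

/-- The components `(-1, 1)` of the differential of `x ↦ x 1 - x 0`. -/
def diffSign : Fin 2 → ℝ := ![-1, 1]

theorem pd_comp_sub {G : ℝ → ℝ} {d : ℝ} {x : Fin 2 → ℝ} (hG : HasDerivAt G d (x 1 - x 0))
    (k : Fin 2) : pd k (fun y => G (y 1 - y 0)) x = diffSign k * d := by
  have hsub : HasFDerivAt (fun y : Fin 2 → ℝ => y 1 - y 0)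
      (ContinuousLinearMap.proj (R := ℝ) (φ := fun _ : Fin 2 => ℝ) 1 -
        ContinuousLinearMap.proj (R := ℝ) (φ := fun _ : Fin 2 => ℝ) 0) x :=
    (hasFDerivAt_apply 1 x).sub (hasFDerivAt_apply 0 x)
  have h := hG.comp_hasFDerivAt x hsub
  change fderiv ℝ (G ∘ fun y : Fin 2 → ℝ => y 1 - y 0) x _ = _
  rw [h.fderiv]
  fin_cases k <;> simp [diffSign]

theorem det_g4 (c : ℝ) (F : ℝ → ℝ) (x : Fin 2 → ℝ) :
    (g4 c F x).det = c * (2 * F (x 1 - x 0) - c) := by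
  simp only [g4, Matrix.det_fin_two_of]
  ring

theorem g4_add_smul_eta2 (β lam : ℝ) (F : ℝ → ℝ) (x : Fin 2 → ℝ) :
    g4 β F x + lam • eta2 = g4 (β + lam) F x := by
  ext i j
  fin_cases i <;> fin_cases j <;> simp [g4, eta2] <;> ring

theorem covMetric_g4 (c : ℝ) (F : ℝ → ℝ) (x : Fin 2 → ℝ) (i j : Fin 2) :
    covMetric (g4 c F) x i j =
      (F (x 1 - x 0) - if i = j then 0 else c) / (c * (2 * F (x 1 - x 0) - c)) := by
  rw [covMetric, Matrix.inv_def, det_g4, g4, Matrix.adjugate_fin_two_of]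
  fin_cases i <;> fin_cases j <;> simp [div_eq_mul_inv] <;> ring

theorem pd_covMetric_g4 {c : ℝ} {F : ℝ → ℝ} (hF : Differentiable ℝ F) {x : Fin 2 → ℝ}
    (hc : c ≠ 0) (hx : 2 * F (x 1 - x 0) - c ≠ 0) (i j k : Fin 2) :
    pd k (fun y => covMetric (g4 c F) y i j) x =
      -(diffSign i * diffSign j * diffSign k) * deriv F (x 1 - x 0)
        / (2 * F (x 1 - x 0) - c) ^ 2 := by
  simp only [covMetric_g4]
  have hF' := (hF (x 1 - x 0)).hasDerivAt
  rw [pd_comp_sub (G := fun t => (F t - if i = j then 0 else c) / (c * (2 * F t - c)))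
    ((hF'.sub_const _).div (((hF'.const_mul 2).sub_const c).const_mul c) (mul_ne_zero hc hx))]
  fin_cases i <;> fin_cases j <;> simp [diffSign] <;> field_simp <;> ring

theorem christoffel_g4 {c : ℝ} {F : ℝ → ℝ} (hF : Differentiable ℝ F) {x : Fin 2 → ℝ}
    (hc : c ≠ 0) (hx : 2 * F (x 1 - x 0) - c ≠ 0) (i j k : Fin 2) :
    christoffel (g4 c F) i j k x =
      -(diffSign i * diffSign j * diffSign k) *
        (deriv F (x 1 - x 0) / (2 * (2 * F (x 1 - x 0) - c))) := by
  simp only [christoffel, pd_covMetric_g4 hF hc hx, Fin.sum_univ_two]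
  fin_cases i <;> fin_cases j <;> fin_cases k <;> simp [diffSign, g4] <;> field_simp <;> ring

theorem pd_christoffel_g4 {c : ℝ} {F : ℝ → ℝ} (hF : ContDiff ℝ 2 F) {x : Fin 2 → ℝ}
    (hc : c ≠ 0) (hx : 2 * F (x 1 - x 0) - c ≠ 0) (i j k l : Fin 2) :
    pd l (christoffel (g4 c F) i j k) x =
      -(diffSign i * diffSign j * diffSign k * diffSign l) *
        deriv (fun t => deriv F t / (2 * (2 * F t - c))) (x 1 - x 0) := by
  have hF₁ : Differentiable ℝ F := hF.differentiable (by norm_num)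
  have hF₂ : Differentiable ℝ (deriv F) := hF.differentiable_deriv_two
  have hev : christoffel (g4 c F) i j k =ᶠ[nhds x] fun y =>
      -(diffSign i * diffSign j * diffSign k) *
        (deriv F (y 1 - y 0) / (2 * (2 * F (y 1 - y 0) - c))) := by
    have hcont : Continuous fun y : Fin 2 → ℝ => 2 * F (y 1 - y 0) - c := by
      have := hF.continuous
      fun_prop
    filter_upwards [hcont.continuousAt.eventually_ne hx] with y hy
    exact christoffel_g4 hF₁ hc hy i j k
  have hdiff : DifferentiableAt ℝ (fun t => deriv F t / (2 * (2 * F t - c))) (x 1 - x 0) :=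
    (hF₂ _).div (((hF₁ _).const_mul 2).sub_const c |>.const_mul 2)
      (mul_ne_zero two_ne_zero hx)
  rw [pd, hev.fderiv_eq, ← pd, pd_comp_sub
    (G := fun t => -(diffSign i * diffSign j * diffSign k) *
      (deriv F t / (2 * (2 * F t - c)))) (hdiff.hasDerivAt.const_mul _)]
  ring

theorem riemann_g4 {c : ℝ} {F : ℝ → ℝ} (hF : ContDiff ℝ 2 F) {x : Fin 2 → ℝ}
    (hx : (g4 c F x).det ≠ 0) (i j k l : Fin 2) : riemann (g4 c F) i j k l x = 0 := by
  rw [det_g4] at hx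
  have hc := left_ne_zero_of_mul hx
  have hx := right_ne_zero_of_mul hx
  simp only [riemann, pd_christoffel_g4 hF hc hx,
    christoffel_g4 (hF.differentiable (by norm_num)) hc hx, Fin.sum_univ_two]
  ring

theorem contraChristoffel_g4 {c : ℝ} {F : ℝ → ℝ} (hF : Differentiable ℝ F) {x : Fin 2 → ℝ}
    (hx : (g4 c F x).det ≠ 0) (i j k : Fin 2) :
    contraChristoffel (g4 c F) i j k x =
      diffSign i * diffSign j * diffSign k * deriv F (x 1 - x 0) / 2 := by
  rw [det_g4] at hx
  have hc := left_ne_zero_of_mul hx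
  have hx := right_ne_zero_of_mul hx
  simp only [contraChristoffel, christoffel_g4 hF hc hx, Fin.sum_univ_two]
  generalize hq : deriv F (x 1 - x 0) / (2 * (2 * F (x 1 - x 0) - c)) = q
  rw [div_eq_iff (mul_ne_zero two_ne_zero hx)] at hq
  rw [hq]
  fin_cases i <;> fin_cases j <;> fin_cases k <;> simp [diffSign, g4] <;> ring

theorem isKillingOn_g4 (c : ℝ) {F : ℝ → ℝ} (hF : Differentiable ℝ F) (U : Set (Fin 2 → ℝ)) :
    IsKillingOn (fun _ => ![1, 1]) (g4 c F) U := by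
  intro x _ i j
  have hF' := (hF (x 1 - x 0)).hasDerivAt
  have hdiag (k : Fin 2) := pd_comp_sub hF' k
  have hoff (k : Fin 2) := pd_comp_sub (G := fun t => -F t + c) (hF'.neg.add_const c) k
  have hconst (k : Fin 2) (a : ℝ) : pd k (fun _ : Fin 2 → ℝ => a) x = 0 := by simp [pd]
  fin_cases i <;> fin_cases j <;>
    simp [lieD, g4, Fin.sum_univ_two, hconst, hdiag, hoff, diffSign]

/-- for a constant `β ≠ 0` and a smooth function `F : ℝ → ℝ`, the
contravariant metric `g₄ = [[F(v−u), −F(v−u)+β],[−F(v−u)+β, F(v−u)]]`, restricted to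
the open set where `2βF(v−u) − β² ≠ 0`, is flat, compatible with `η`, and
`f = ∂_u + ∂_v` is a Killing vector field of `g₄`. -/
theorem stmt8 (β : ℝ) (hβ : β ≠ 0) (F : ℝ → ℝ) (hF : ContDiff ℝ (⊤ : ℕ∞) F) :
    IsFlatOn (g4 β F) (U4 β F) ∧
    CompatibleOn (g4 β F) (fun _ => eta2) (U4 β F) ∧
    IsKillingOn (fun _ => ![1, 1]) (g4 β F) (U4 β F) := by
  have hF₂ : ContDiff ℝ 2 F := contDiff_infty.mp hF 2
  have hF₁ : Differentiable ℝ F := hF₂.differentiable (by norm_num)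
  have hdet : ∀ x ∈ U4 β F, (g4 β F x).det ≠ 0 := by
    intro x hx h
    rw [det_g4] at h
    exact hx (by linear_combination h)
  refine ⟨fun x hx => riemann_g4 hF₂ (hdet x hx), fun lam x hx hlam => ?_,
    isKillingOn_g4 β hF₁ _⟩
  simp only [g4_add_smul_eta2] at hlam ⊢
  refine ⟨riemann_g4 hF₂ hlam, fun i j k => ?_⟩
  exact (contraChristoffel_g4 hF₁ hlam i j k).trans
    (contraChristoffel_g4 hF₁ (hdet x hx) i j k).symm
end

section
/- Let α, β, γ, ε be constants and define F(u,v) = (γuv + ε + √((γ²−4α)u²v² + 2γεuv + ε²))/(2u²) on an open set where u ≠ 0 and the argument of the square root is positive. Then: (1) F satisfies the quadratic relation u²F² − (γuv + ε)F + αv² = 0; (2) F satisfies u ∂F/∂u − v ∂F/∂v = −2F, and consequently f = u∂_u − v∂_v is a Killing vector field of the contravariant metric g₉ with matrix [[α/F, β],[β, F]]. -/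
open scoped BigOperators

/-- The function `F(u,v) = (γuv + ε + √((γ²−4α)u²v² + 2γεuv + ε²))/(2u²)`, with
`u = x 0`, `v = x 1`. -/
noncomputable def F9 (α γ ε : ℝ) (x : Fin 2 → ℝ) : ℝ :=
  (γ * x 0 * x 1 + ε +
    Real.sqrt ((γ ^ 2 - 4 * α) * (x 0) ^ 2 * (x 1) ^ 2 + 2 * γ * ε * x 0 * x 1 + ε ^ 2)) /
    (2 * (x 0) ^ 2)

/-- Euler's identity for functions that are homogeneous along the flow of `u∂_u − v∂_v`. -/
lemma euler_of_flow_homogeneous {H : (Fin 2 → ℝ) → ℝ} {x : Fin 2 → ℝ} {c : ℝ}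
    (hH : DifferentiableAt ℝ H x)
    (hflow : ∀ t : ℝ, H ![Real.exp t * x 0, Real.exp (-t) * x 1] = Real.exp (c * t) * H x) :
    x 0 * pd 0 H x - x 1 * pd 1 H x = c * H x := by
  have hx : ![Real.exp 0 * x 0, Real.exp (-0) * x 1] = x := by
    ext i; fin_cases i <;> simp
  have hcurve : HasDerivAt (fun t : ℝ => ![Real.exp t * x 0, Real.exp (-t) * x 1])
      ![x 0, -x 1] 0 := by
    rw [hasDerivAt_pi]
    intro i
    fin_cases i
    · simpa using (Real.hasDerivAt_exp 0).mul_const (x 0)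
    · simpa using ((hasDerivAt_id (0 : ℝ)).neg.exp).mul_const (x 1)
  have hH' : HasFDerivAt H (fderiv ℝ H x)
      ((fun t : ℝ => ![Real.exp t * x 0, Real.exp (-t) * x 1]) 0) := by
    simpa only [hx] using hH.hasFDerivAt
  have hcomp := hH'.comp_hasDerivAt (0 : ℝ) hcurve
  have hexp : HasDerivAt (fun t : ℝ => Real.exp (c * t) * H x) (c * H x) 0 := by
    simpa using (((hasDerivAt_id (0 : ℝ)).const_mul c).exp).mul_const (H x)
  have heq := hcomp.unique (hexp.congr_of_eventuallyEq (.of_forall hflow))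
  have hdecomp : (![x 0, -x 1] : Fin 2 → ℝ)
      = x 0 • Pi.single 0 1 - x 1 • Pi.single 1 1 := by
    ext i; fin_cases i <;> simp
  rw [hdecomp, map_sub, map_smul, map_smul] at heq
  simpa [pd] using heq

lemma F9_flow (α γ ε : ℝ) (x : Fin 2 → ℝ) (t : ℝ) :
    F9 α γ ε ![Real.exp t * x 0, Real.exp (-t) * x 1] = Real.exp (-2 * t) * F9 α γ ε x := by
  have hinv : Real.exp t * Real.exp (-t) = 1 := by rw [← Real.exp_add]; simp
  have hsq : Real.exp (-2 * t) = (Real.exp t ^ 2)⁻¹ := by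
    rw [← Real.exp_nat_mul, ← Real.exp_neg]; congr 1; push_cast; ring
  have hprod : Real.exp t * x 0 * (Real.exp (-t) * x 1) = x 0 * x 1 := by
    linear_combination (x 0 * x 1) * hinv
  have hlin : ∀ a : ℝ, a * (Real.exp t * x 0) * (Real.exp (-t) * x 1) = a * x 0 * x 1 :=
    fun a => by linear_combination a * hprod
  have hquad : ∀ a : ℝ, a * (Real.exp t * x 0) ^ 2 * (Real.exp (-t) * x 1) ^ 2
      = a * x 0 ^ 2 * x 1 ^ 2 := fun a => by
    rw [mul_assoc, ← mul_pow, hprod]; ring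
  simp only [F9, Matrix.cons_val_zero, Matrix.cons_val_one, hlin, hquad, hsq]
  rw [mul_pow, div_eq_mul_inv, div_eq_mul_inv, mul_inv, mul_inv, mul_inv]
  ring

lemma F9_differentiableAt {α γ ε : ℝ} {x : Fin 2 → ℝ} (hu : x 0 ≠ 0)
    (hpos : 0 < (γ ^ 2 - 4 * α) * (x 0) ^ 2 * (x 1) ^ 2 + 2 * γ * ε * x 0 * x 1 + ε ^ 2) :
    DifferentiableAt ℝ (F9 α γ ε) x := by
  have hsqrt : DifferentiableAt ℝ (fun y : Fin 2 → ℝ =>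
      Real.sqrt ((γ ^ 2 - 4 * α) * (y 0) ^ 2 * (y 1) ^ 2 + 2 * γ * ε * y 0 * y 1 + ε ^ 2)) x :=
    DifferentiableAt.sqrt (by fun_prop) hpos.ne'
  have hden : DifferentiableAt ℝ (fun y : Fin 2 → ℝ => (2 * (y 0) ^ 2)⁻¹) x :=
    DifferentiableAt.fun_inv (by fun_prop) (by positivity)
  unfold F9
  simp only [div_eq_mul_inv]
  exact DifferentiableAt.fun_mul (DifferentiableAt.fun_add (by fun_prop) hsqrt) hden

lemma F9_quadratic {α γ ε : ℝ} {x : Fin 2 → ℝ} (hu : x 0 ≠ 0)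
    (hpos : 0 < (γ ^ 2 - 4 * α) * (x 0) ^ 2 * (x 1) ^ 2 + 2 * γ * ε * x 0 * x 1 + ε ^ 2) :
    (x 0) ^ 2 * (F9 α γ ε x) ^ 2 - (γ * x 0 * x 1 + ε) * F9 α γ ε x + α * (x 1) ^ 2 = 0 := by
  have hs := Real.sq_sqrt hpos.le
  unfold F9
  set s := Real.sqrt _
  field_simp
  linear_combination hs

lemma F9_euler {α γ ε : ℝ} {x : Fin 2 → ℝ} (hu : x 0 ≠ 0)
    (hpos : 0 < (γ ^ 2 - 4 * α) * (x 0) ^ 2 * (x 1) ^ 2 + 2 * γ * ε * x 0 * x 1 + ε ^ 2) :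
    x 0 * pd 0 (F9 α γ ε) x - x 1 * pd 1 (F9 α γ ε) x = -2 * F9 α γ ε x :=
  euler_of_flow_homogeneous (F9_differentiableAt hu hpos) (F9_flow α γ ε x)

/-- At a zero of `F9` both sides vanish: there `a / F9` takes the value `0`, and its `fderiv` is
either `0` or governed by homogeneity. -/
lemma div_F9_euler (a : ℝ) {α γ ε : ℝ} {x : Fin 2 → ℝ} (hu : x 0 ≠ 0)
    (hpos : 0 < (γ ^ 2 - 4 * α) * (x 0) ^ 2 * (x 1) ^ 2 + 2 * γ * ε * x 0 * x 1 + ε ^ 2) :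
    x 0 * pd 0 (fun y => a / F9 α γ ε y) x - x 1 * pd 1 (fun y => a / F9 α γ ε y) x
      = 2 * (a / F9 α γ ε x) := by
  by_cases hd : DifferentiableAt ℝ (fun y => a / F9 α γ ε y) x
  · refine euler_of_flow_homogeneous hd fun t => ?_
    rw [F9_flow, neg_mul, Real.exp_neg, div_mul_eq_div_div, div_inv_eq_mul]
    ring
  · have hF : F9 α γ ε x = 0 := by
      by_contra hF
      simp only [div_eq_mul_inv] at hd
      exact hd (((F9_differentiableAt hu hpos).fun_inv hF).const_mul a)
    simp [pd, fderiv_zero_of_not_differentiableAt hd, hF]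

/-- on an open set where `u ≠ 0` and the argument of the square root is
positive, (1) `F` satisfies the quadratic relation `u²F² − (γuv + ε)F + αv² = 0`;
(2) `F` satisfies `u ∂F/∂u − v ∂F/∂v = −2F`, and consequently `f = u∂_u − v∂_v` is a
Killing vector field of the contravariant metric `g₉ = [[α/F, β],[β, F]]`. -/
theorem stmt9 (α β γ ε : ℝ) (U : Set (Fin 2 → ℝ)) (hU : IsOpen U)
    (hdom : ∀ x ∈ U, x 0 ≠ 0 ∧
      0 < (γ ^ 2 - 4 * α) * (x 0) ^ 2 * (x 1) ^ 2 + 2 * γ * ε * x 0 * x 1 + ε ^ 2) :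
    (∀ x ∈ U, (x 0) ^ 2 * (F9 α γ ε x) ^ 2 - (γ * x 0 * x 1 + ε) * F9 α γ ε x
        + α * (x 1) ^ 2 = 0) ∧
    (∀ x ∈ U, x 0 * pd 0 (F9 α γ ε) x - x 1 * pd 1 (F9 α γ ε) x = -2 * F9 α γ ε x) ∧
    IsKillingOn (fun x => ![x 0, -x 1])
      (fun x => !![α / F9 α γ ε x, β; β, F9 α γ ε x]) U := by
  refine ⟨fun x hx => F9_quadratic (hdom x hx).1 (hdom x hx).2,
    fun x hx => F9_euler (hdom x hx).1 (hdom x hx).2, fun x hx i j => ?_⟩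
  obtain ⟨hu, hpos⟩ := hdom x hx
  have hF := F9_euler hu hpos
  have hG := div_F9_euler α hu hpos
  have hconst : ∀ k, pd k (fun _ : Fin 2 → ℝ => β) x = 0 := fun k => by simp [pd]
  have hcoord : ∀ k l : Fin 2, pd k (fun y : Fin 2 → ℝ => y l) x
      = (Pi.single k 1 : Fin 2 → ℝ) l := fun k l => by
    simp [pd, (hasFDerivAt_apply (𝕜 := ℝ) l x).fderiv]
  have hneg : ∀ k l : Fin 2, pd k (fun y : Fin 2 → ℝ => -y l) x
      = -(Pi.single k 1 : Fin 2 → ℝ) l := fun k l => by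
    simp [pd, (hasFDerivAt_apply (𝕜 := ℝ) l x).fun_neg.fderiv]
  fin_cases i <;> fin_cases j <;>
    simp [lieD, Fin.sum_univ_two, hconst, hcoord, hneg] <;> linarith
end

section
/- Let γ : I → ℝ be a smooth function on an open interval I ⊆ ℝ, and define f(v,w) = −(1/16) v⁴ γ(w) on ℝ × I. Then f satisfies the third-order PDE f_{www} = (f_{vvw})² − f_{vww} f_{vvv} at all points (v,w) with v ≠ 0 if and only if γ satisfies the Chazy equation γ''' = 6γγ'' − 9(γ')² on I. -/
/-- Partial derivative with respect to the first variable `v` of a function on `ℝ²`. -/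
noncomputable def Dv (f : ℝ × ℝ → ℝ) (p : ℝ × ℝ) : ℝ := fderiv ℝ f p ((1 : ℝ), (0 : ℝ))

/-- Partial derivative with respect to the second variable `w` of a function on `ℝ²`. -/
noncomputable def Dw (f : ℝ × ℝ → ℝ) (p : ℝ × ℝ) : ℝ := fderiv ℝ f p ((0 : ℝ), (1 : ℝ))

theorem hasFDerivAt_monomial_mul {φ : ℝ → ℝ} {p : ℝ × ℝ} (hφ : DifferentiableAt ℝ φ p.2)
    (c : ℝ) (n : ℕ) :
    HasFDerivAt (fun q : ℝ × ℝ => c * q.1 ^ n * φ q.2)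
      ((c * p.1 ^ n) • (deriv φ p.2 • ContinuousLinearMap.snd ℝ ℝ ℝ) +
        φ p.2 • ((c * (n * p.1 ^ (n - 1))) • ContinuousLinearMap.fst ℝ ℝ ℝ)) p := by
  have h1 : HasFDerivAt (fun q : ℝ × ℝ => c * q.1 ^ n)
      ((c * (n * p.1 ^ (n - 1))) • ContinuousLinearMap.fst ℝ ℝ ℝ) p :=
    ((hasDerivAt_pow n p.1).const_mul c).comp_hasFDerivAt p hasFDerivAt_fst
  have h2 : HasFDerivAt (fun q : ℝ × ℝ => φ q.2)
      (deriv φ p.2 • ContinuousLinearMap.snd ℝ ℝ ℝ) p :=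
    hφ.hasDerivAt.comp_hasFDerivAt p hasFDerivAt_snd
  exact h1.mul h2

theorem hasFDerivAt_of_eqOn_monomial_mul {I : Set ℝ} (hI : IsOpen I) {φ : ℝ → ℝ}
    (hφ : DifferentiableOn ℝ φ I) {g : ℝ × ℝ → ℝ} {c : ℝ} {n : ℕ}
    (hg : Set.EqOn g (fun q => c * q.1 ^ n * φ q.2) (Prod.snd ⁻¹' I))
    {p : ℝ × ℝ} (hp : p ∈ Prod.snd ⁻¹' I) :
    HasFDerivAt g
      ((c * p.1 ^ n) • (deriv φ p.2 • ContinuousLinearMap.snd ℝ ℝ ℝ) +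
        φ p.2 • ((c * (n * p.1 ^ (n - 1))) • ContinuousLinearMap.fst ℝ ℝ ℝ)) p :=
  (hasFDerivAt_monomial_mul (hφ.differentiableAt (hI.mem_nhds hp)) c n).congr_of_eventuallyEq
    (hg.eventuallyEq_of_mem ((hI.preimage continuous_snd).mem_nhds hp))

theorem eqOn_Dv_monomial_mul {I : Set ℝ} (hI : IsOpen I) {φ : ℝ → ℝ}
    (hφ : DifferentiableOn ℝ φ I) {g : ℝ × ℝ → ℝ} {c : ℝ} {n : ℕ}
    (hg : Set.EqOn g (fun q => c * q.1 ^ n * φ q.2) (Prod.snd ⁻¹' I)) :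
    Set.EqOn (Dv g) (fun q => c * n * q.1 ^ (n - 1) * φ q.2) (Prod.snd ⁻¹' I) := by
  intro p hp
  simp only [Dv, (hasFDerivAt_of_eqOn_monomial_mul hI hφ hg hp).fderiv]
  simp
  ring

theorem eqOn_Dw_monomial_mul {I : Set ℝ} (hI : IsOpen I) {φ : ℝ → ℝ}
    (hφ : DifferentiableOn ℝ φ I) {g : ℝ × ℝ → ℝ} {c : ℝ} {n : ℕ}
    (hg : Set.EqOn g (fun q => c * q.1 ^ n * φ q.2) (Prod.snd ⁻¹' I)) :
    Set.EqOn (Dw g) (fun q => c * q.1 ^ n * deriv φ q.2) (Prod.snd ⁻¹' I) := by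
  intro p hp
  simp only [Dw, (hasFDerivAt_of_eqOn_monomial_mul hI hφ hg hp).fderiv]
  simp

/-- with `f(v,w) = −(1/16)v⁴γ(w)` for `γ` smooth on an open interval `I`,
`f` satisfies `f_{www} = (f_{vvw})² − f_{vww} f_{vvv}` at all points `(v,w)` with
`v ≠ 0`, `w ∈ I`, iff `γ` satisfies the Chazy equation `γ''' = 6γγ'' − 9(γ')²` on `I`. -/
theorem stmt11 (I : Set ℝ) (hI : IsOpen I) (hIint : Convex ℝ I)
    (γ : ℝ → ℝ) (hγ : ContDiffOn ℝ (⊤ : ℕ∞) γ I) :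
    (∀ v w : ℝ, v ≠ 0 → w ∈ I →
      Dw (Dw (Dw (fun p => -(1 / 16) * p.1 ^ 4 * γ p.2))) (v, w) =
        (Dw (Dv (Dv (fun p => -(1 / 16) * p.1 ^ 4 * γ p.2))) (v, w)) ^ 2 -
          Dw (Dw (Dv (fun p => -(1 / 16) * p.1 ^ 4 * γ p.2))) (v, w) *
            Dv (Dv (Dv (fun p => -(1 / 16) * p.1 ^ 4 * γ p.2))) (v, w)) ↔
    (∀ w ∈ I, deriv (deriv (deriv γ)) w =
      6 * γ w * deriv (deriv γ) w - 9 * (deriv γ w) ^ 2) := by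
  have hγ₁ : ContDiffOn ℝ (⊤ : ℕ∞) (deriv γ) I := hγ.deriv_of_isOpen hI (by simp)
  have hγ₂ : ContDiffOn ℝ (⊤ : ℕ∞) (deriv (deriv γ)) I := hγ₁.deriv_of_isOpen hI (by simp)
  have d₀ := hγ.differentiableOn (by simp)
  have d₁ := hγ₁.differentiableOn (by simp)
  have d₂ := hγ₂.differentiableOn (by simp)
  set f : ℝ × ℝ → ℝ := fun p => -(1 / 16) * p.1 ^ 4 * γ p.2
  have hf : Set.EqOn f (fun p => -(1 / 16) * p.1 ^ 4 * γ p.2) (Prod.snd ⁻¹' I) :=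
    fun _ _ => rfl
  have hv := eqOn_Dv_monomial_mul hI d₀ hf
  have hvv := eqOn_Dv_monomial_mul hI d₀ hv
  have hvvv := eqOn_Dv_monomial_mul hI d₀ hvv
  have hvvw := eqOn_Dw_monomial_mul hI d₀ hvv
  have hvww := eqOn_Dw_monomial_mul hI d₁ (eqOn_Dw_monomial_mul hI d₀ hv)
  have hwww := eqOn_Dw_monomial_mul hI d₂
    (eqOn_Dw_monomial_mul hI d₁ (eqOn_Dw_monomial_mul hI d₀ hf))
  constructor
  · intro h w hw
    have hp : ((1 : ℝ), w) ∈ Prod.snd ⁻¹' I := hw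
    have key := h 1 w one_ne_zero hw
    rw [hwww hp, hvvw hp, hvww hp, hvvv hp] at key
    norm_num at key
    linarith
  · intro h v w _ hw
    have hp : (v, w) ∈ Prod.snd ⁻¹' I := hw
    rw [hwww hp, hvvw hp, hvww hp, hvvv hp]
    norm_num
    rw [h w hw]
    ring
end

section
/- For (v,w) ∈ ℝ² with w ≠ 0: (1) the velocity matrix V of the hydrodynamic type system u_t = −(3v²/(2w²))v_x + (v³/w³)w_x, v_t = u_x + (3v/w)v_x − (3v²/(2w²))w_x, w_t = v_x, namely V = [[0, −3v²/(2w²), v³/w³],[1, 3v/w, −3v²/(2w²)],[0, 1, 0]], has characteristic polynomial (λ − v/w)³; (2) the velocity matrix W of the system u_y = (v³/w³)v_x − (3v⁴/(4w⁴))w_x, v_y = −(3v²/(2w²))v_x + (v³/w³)w_x, w_y = u_x, namely W = [[0, v³/w³, −3v⁴/(4w⁴)],[0, −3v²/(2w²), v³/w³],[1, 0, 0]], has characteristic polynomial (λ + v²/(2w²))³. In particular, each velocity matrix has a single characteristic root. -/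
open Polynomial

/-- The velocity matrix of the system
`u_t = −(3v²/(2w²))v_x + (v³/w³)w_x, v_t = u_x + (3v/w)v_x − (3v²/(2w²))w_x, w_t = v_x`. -/
noncomputable def V14 (v w : ℝ) : Matrix (Fin 3) (Fin 3) ℝ :=
  !![0, -3 * v ^ 2 / (2 * w ^ 2), v ^ 3 / w ^ 3;
     1, 3 * v / w, -3 * v ^ 2 / (2 * w ^ 2);
     0, 1, 0]

/-- The velocity matrix of the system
`u_y = (v³/w³)v_x − (3v⁴/(4w⁴))w_x, v_y = −(3v²/(2w²))v_x + (v³/w³)w_x, w_y = u_x`. -/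
noncomputable def W14 (v w : ℝ) : Matrix (Fin 3) (Fin 3) ℝ :=
  !![0, v ^ 3 / w ^ 3, -3 * v ^ 4 / (4 * w ^ 4);
     0, -3 * v ^ 2 / (2 * w ^ 2), v ^ 3 / w ^ 3;
     1, 0, 0]

theorem V14_charpoly (v w : ℝ) : (V14 v w).charpoly = (X - C (v / w)) ^ 3 := by
  refine Polynomial.funext fun t => ?_
  rw [Matrix.eval_charpoly, V14, Matrix.det_fin_three]
  simp [Matrix.scalar_apply]
  ring

theorem W14_charpoly (v w : ℝ) :
    (W14 v w).charpoly = (X + C (v ^ 2 / (2 * w ^ 2))) ^ 3 := by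
  refine Polynomial.funext fun t => ?_
  rw [Matrix.eval_charpoly, W14, Matrix.det_fin_three]
  simp [Matrix.scalar_apply]
  ring

/-- for `w ≠ 0`, the characteristic polynomial of `V14` is `(λ − v/w)³`,
that of `W14` is `(λ + v²/(2w²))³`; in particular each velocity matrix has a single
characteristic root. -/
theorem stmt14 (v w : ℝ) (hw : w ≠ 0) :
    (V14 v w).charpoly = (X - C (v / w)) ^ 3 ∧
    (W14 v w).charpoly = (X + C (v ^ 2 / (2 * w ^ 2))) ^ 3 ∧
    (∀ μ : ℝ, (V14 v w).charpoly.IsRoot μ ↔ μ = v / w) ∧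
    (∀ μ : ℝ, (W14 v w).charpoly.IsRoot μ ↔ μ = -(v ^ 2 / (2 * w ^ 2))) := by
  have hV := V14_charpoly v w
  have hW := W14_charpoly v w
  refine ⟨hV, hW, fun μ => ?_, fun μ => ?_⟩
  · simp [hV, sub_eq_zero]
  · simp [hW, add_eq_zero_iff_eq_neg]
end

section
/- Let u, v, w be smooth real-valued functions of (t,x) on an open subset of ℝ² with w nowhere zero, and define the density h(t,x) = u v + v³/(2w) − (x²/2)w (evaluated at (u(t,x), v(t,x), w(t,x))). Then (u,v,w) satisfies the system u_t = −(3v²/(2w²))v_x + (v³/w³)w_x − x, v_t = u_x + (3v/w)v_x − (3v²/(2w²))w_x, w_t = v_x if and only if u_t = ∂_x(∂h/∂w), v_t = ∂_x(∂h/∂v), w_t = ∂_x(∂h/∂u); that is, the system is Hamiltonian with operator A^{ij} = η^{ij}∂_x, η^{ij} = δ_{i+j,4}, and Hamiltonian F = ∫(uv + v³/(2w) − (x²/2)w) dx. -/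
/-- Partial derivative with respect to the first variable `t` of a function on `ℝ²`. -/
noncomputable def Dt (f : ℝ × ℝ → ℝ) (p : ℝ × ℝ) : ℝ := fderiv ℝ f p ((1 : ℝ), (0 : ℝ))

/-- Partial derivative with respect to the second variable `x` of a function on `ℝ²`. -/
noncomputable def Dx (f : ℝ × ℝ → ℝ) (p : ℝ × ℝ) : ℝ := fderiv ℝ f p ((0 : ℝ), (1 : ℝ))

/-- The density `h(x,u,v,w) = uv + v³/(2w) − (x²/2)w` of the Hamiltonian `F = ∫ h dx`. -/
noncomputable def hdens (x u v w : ℝ) : ℝ := u * v + v ^ 3 / (2 * w) - x ^ 2 / 2 * w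

theorem hasDerivAt_slice {f : ℝ × ℝ → ℝ} {p : ℝ × ℝ} (hf : DifferentiableAt ℝ f p) :
    HasDerivAt (fun s => f (p.1, s)) (Dx f p) p.2 :=
  HasFDerivAt.comp_hasDerivAt (f := fun s : ℝ => (p.1, s)) p.2 hf.hasFDerivAt
    ((hasDerivAt_const p.2 p.1).prodMk (hasDerivAt_id p.2))

theorem deriv_hdens_u (x u v w : ℝ) : deriv (fun U => hdens x U v w) u = v := by
  have h : HasDerivAt (fun U => hdens x U v w) (1 * v) u :=
    ((((hasDerivAt_id u).mul_const v).add_const _).sub_const _)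
  rw [h.deriv, one_mul]

theorem deriv_hdens_v (x u v w : ℝ) :
    deriv (fun V => hdens x u V w) v = u + 3 * v ^ 2 / (2 * w) := by
  have h := ((((hasDerivAt_id v).const_mul u).add
    (((hasDerivAt_id v).pow 3).div_const (2 * w))).sub_const (x ^ 2 / 2 * w))
  refine HasDerivAt.deriv (h.congr_deriv ?_)
  simp

theorem deriv_hdens_w (x u v : ℝ) {w : ℝ} (hw : w ≠ 0) :
    deriv (fun W => hdens x u v W) w = -(v ^ 3 / (2 * w ^ 2)) - x ^ 2 / 2 := by
  have h := (((hasDerivAt_const w (v ^ 3)).div ((hasDerivAt_id w).const_mul 2)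
    (mul_ne_zero two_ne_zero hw)).const_add (u * v)).sub
    ((hasDerivAt_id w).const_mul (x ^ 2 / 2))
  refine HasDerivAt.deriv (h.congr_deriv ?_)
  simp only [id]
  field_simp
  ring

theorem Dx_congr {f g : ℝ × ℝ → ℝ} {p : ℝ × ℝ} (h : f =ᶠ[nhds p] g) : Dx f p = Dx g p := by
  rw [Dx, Dx, h.fderiv_eq]

section VariationalDerivatives

variable {u v w : ℝ × ℝ → ℝ} {p : ℝ × ℝ}

theorem Dx_deriv_hdens_v (hu : DifferentiableAt ℝ u p) (hv : DifferentiableAt ℝ v p)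
    (hw : DifferentiableAt ℝ w p) (h0 : w p ≠ 0) :
    Dx (fun q => deriv (fun V => hdens q.2 (u q) V (w q)) (v q)) p =
      Dx u p + 3 * v p / w p * Dx v p - 3 * (v p) ^ 2 / (2 * (w p) ^ 2) * Dx w p := by
  simp only [deriv_hdens_v]
  have h2 : 2 * w p ≠ 0 := mul_ne_zero two_ne_zero h0
  have hd : DifferentiableAt ℝ (fun q => u q + 3 * v q ^ 2 / (2 * w q)) p := by
    fun_prop (disch := assumption)
  have h := (hasDerivAt_slice hu).add
    ((((hasDerivAt_slice hv).pow 2).const_mul 3).div ((hasDerivAt_slice hw).const_mul 2) h2)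
  refine ((hasDerivAt_slice hd).unique h).trans ?_
  simp only [Prod.mk.eta, Pi.pow_apply]
  field_simp
  ring

theorem Dx_deriv_hdens_w (hv : DifferentiableAt ℝ v p) (hw : DifferentiableAt ℝ w p)
    (h0 : w p ≠ 0) :
    Dx (fun q => deriv (fun W => hdens q.2 (u q) (v q) W) (w q)) p =
      -(3 * (v p) ^ 2 / (2 * (w p) ^ 2)) * Dx v p + (v p) ^ 3 / (w p) ^ 3 * Dx w p - p.2 := by
  have he : (fun q => deriv (fun W => hdens q.2 (u q) (v q) W) (w q)) =ᶠ[nhds p]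
      fun q => -(v q ^ 3 / (2 * w q ^ 2)) - q.2 ^ 2 / 2 :=
    (hw.continuousAt.eventually_ne h0).mono fun q hq => deriv_hdens_w q.2 (u q) (v q) hq
  rw [Dx_congr he]
  have h2 : 2 * w p ^ 2 ≠ 0 := mul_ne_zero two_ne_zero (pow_ne_zero 2 h0)
  have hd : DifferentiableAt ℝ (fun q : ℝ × ℝ => -(v q ^ 3 / (2 * w q ^ 2)) - q.2 ^ 2 / 2) p := by
    fun_prop (disch := assumption)
  have h := (((hasDerivAt_slice hv).pow 3).div
    (((hasDerivAt_slice hw).pow 2).const_mul 2) h2).neg.sub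
    (((hasDerivAt_id p.2).pow 2).div_const 2)
  refine ((hasDerivAt_slice hd).unique h).trans ?_
  simp only [Prod.mk.eta, Pi.pow_apply, id]
  field_simp
  ring

end VariationalDerivatives

/-- for smooth `u`, `v`, `w` on an open set `U ⊆ ℝ²` with `w` nowhere
zero, the system `u_t = −(3v²/(2w²))v_x + (v³/w³)w_x − x`,
`v_t = u_x + (3v/w)v_x − (3v²/(2w²))w_x`, `w_t = v_x` holds iff
`u_t = ∂_x(∂h/∂w)`, `v_t = ∂_x(∂h/∂v)`, `w_t = ∂_x(∂h/∂u)`, i.e. the system is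
Hamiltonian with the operator `A^{ij} = η^{ij}∂_x`, `η^{ij} = δ_{i+j,4}`, and
Hamiltonian `F = ∫ (uv + v³/(2w) − (x²/2)w) dx`. -/
theorem stmt19 (U : Set (ℝ × ℝ)) (hU : IsOpen U) (u v w : ℝ × ℝ → ℝ)
    (hu : ContDiffOn ℝ (⊤ : ℕ∞) u U) (hv : ContDiffOn ℝ (⊤ : ℕ∞) v U) (hw : ContDiffOn ℝ (⊤ : ℕ∞) w U)
    (hw0 : ∀ p ∈ U, w p ≠ 0) :
    (∀ p ∈ U,
      Dt u p = -(3 * (v p) ^ 2 / (2 * (w p) ^ 2)) * Dx v p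
          + (v p) ^ 3 / (w p) ^ 3 * Dx w p - p.2 ∧
      Dt v p = Dx u p + 3 * v p / w p * Dx v p
          - 3 * (v p) ^ 2 / (2 * (w p) ^ 2) * Dx w p ∧
      Dt w p = Dx v p) ↔
    (∀ p ∈ U,
      Dt u p = Dx (fun q => deriv (fun W => hdens q.2 (u q) (v q) W) (w q)) p ∧
      Dt v p = Dx (fun q => deriv (fun V => hdens q.2 (u q) V (w q)) (v q)) p ∧
      Dt w p = Dx (fun q => deriv (fun Uu => hdens q.2 Uu (v q) (w q)) (u q)) p) := by
  have hdiff {f : ℝ × ℝ → ℝ} (hf : ContDiffOn ℝ (⊤ : ℕ∞) f U) {p : ℝ × ℝ} (hp : p ∈ U) :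
      DifferentiableAt ℝ f p :=
    (hf.contDiffAt (hU.mem_nhds hp)).differentiableAt (by simp)
  refine forall₂_congr fun p hp => ?_
  rw [Dx_deriv_hdens_w (hdiff hv hp) (hdiff hw hp) (hw0 p hp),
    Dx_deriv_hdens_v (hdiff hu hp) (hdiff hv hp) (hdiff hw hp) (hw0 p hp)]
  simp only [deriv_hdens_u]
end
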